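/- arXiv:2101.05679 — 2 statements merged into one kernel-verified Lean document; each statement's English description precedes it below -/
import Mathlib

section
/- Let n ≥ 1, y₁,…,yₙ ∈ ℝᵈ, h ∈ ℝⁿ and τ > 0, and write cᵢ(x) = (⟨x, yᵢ⟩ + hᵢ)/τ. The smoothed optimal transport map T̂ : ℝᵈ → ℝᵈ, T̂(x) = ( ∑ᵢ yᵢ · exp(cᵢ(x)) ) / ( ∑ᵢ exp(cᵢ(x)) ), is Lipschitz continuous with Lipschitz constant (max_{1 ≤ i ≤ n} ‖yᵢ‖₂²) / τ with respect to the Euclidean norm. -/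
open Real Finset RealInnerProductSpace

/-- The covariance of two bounded functions under (unnormalised) nonnegative weights is at most
the product of their bounds. -/
lemma abs_weighted_covariance_le {ι : Type*} (s : Finset ι) (e a b : ι → ℝ) {A B : ℝ}
    (he : ∀ i ∈ s, 0 ≤ e i) (hA : 0 ≤ A) (hB : 0 ≤ B)
    (ha : ∀ i ∈ s, |a i| ≤ A) (hb : ∀ i ∈ s, |b i| ≤ B) :
    |(∑ i ∈ s, e i * a i * b i) * (∑ i ∈ s, e i) - (∑ i ∈ s, e i * b i) * (∑ i ∈ s, e i * a i)|
      ≤ A * B * (∑ i ∈ s, e i) ^ 2 := by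
  set S := ∑ i ∈ s, e i with hS
  set P := ∑ i ∈ s, e i * b i with hP
  have hS0 : 0 ≤ S := sum_nonneg he
  have sq_bound : ∀ (c : ι → ℝ) (C : ℝ), (∀ i ∈ s, |c i| ≤ C) →
      ∑ i ∈ s, e i * c i ^ 2 ≤ S * C ^ 2 := by
    intro c C hc
    rw [hS, sum_mul]
    refine sum_le_sum fun i hi => mul_le_mul_of_nonneg_left ?_ (he i hi)
    exact sq_le_sq' (abs_le.mp (hc i hi)).1 (abs_le.mp (hc i hi)).2
  have hcov : (∑ i ∈ s, e i * a i * b i) * S - P * (∑ i ∈ s, e i * a i)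
      = ∑ i ∈ s, e i * a i * (S * b i - P) := by
    rw [sum_mul, mul_sum, ← sum_sub_distrib]
    exact sum_congr rfl fun i _ => by ring
  have hvar : ∑ i ∈ s, e i * (S * b i - P) ^ 2 = S ^ 2 * (∑ i ∈ s, e i * b i ^ 2) - S * P ^ 2 := by
    have : ∀ i ∈ s, e i * (S * b i - P) ^ 2
        = S ^ 2 * (e i * b i ^ 2) - 2 * S * P * (e i * b i) + P ^ 2 * e i := fun i _ => by ring
    rw [sum_congr rfl this, sum_add_distrib, sum_sub_distrib, ← mul_sum, ← mul_sum, ← mul_sum,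
      ← hS, ← hP]
    ring
  have hvar_le : ∑ i ∈ s, e i * (S * b i - P) ^ 2 ≤ S ^ 2 * (S * B ^ 2) := by
    rw [hvar]
    have := mul_le_mul_of_nonneg_left (sq_bound b B hb) (sq_nonneg S)
    have := mul_nonneg hS0 (sq_nonneg P)
    linarith
  rw [hcov]
  refine abs_le_of_sq_le_sq ?_ (by positivity)
  calc (∑ i ∈ s, e i * a i * (S * b i - P)) ^ 2
      ≤ (∑ i ∈ s, e i * a i ^ 2) * ∑ i ∈ s, e i * (S * b i - P) ^ 2 :=
        sum_sq_le_sum_mul_sum_of_sq_le_mul s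
          (fun i hi => mul_nonneg (he i hi) (sq_nonneg _))
          (fun i hi => mul_nonneg (he i hi) (sq_nonneg _)) (fun i _ => le_of_eq (by ring))
    _ ≤ (S * A ^ 2) * (S ^ 2 * (S * B ^ 2)) :=
        mul_le_mul (sq_bound a A ha) hvar_le
          (sum_nonneg fun i hi => mul_nonneg (he i hi) (sq_nonneg _)) (by positivity)
    _ = (A * B * S ^ 2) ^ 2 := by ring

/-- A softmax average of bounded values changes by at most `A * B` when the exponents move by at
most `A` and the values are bounded by `B`. -/
lemma abs_softmax_average_sub_le {ι : Type*} [Fintype ι] [Nonempty ι] (a b c : ι → ℝ) {A B : ℝ}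
    (hA : 0 ≤ A) (hB : 0 ≤ B) (ha : ∀ i, |a i| ≤ A) (hb : ∀ i, |b i| ≤ B) :
    |(∑ i, exp (c i + a i) * b i) / (∑ i, exp (c i + a i))
        - (∑ i, exp (c i) * b i) / (∑ i, exp (c i))| ≤ A * B := by
  have hexp : ∀ (i : ι) (t : ℝ),
      HasDerivAt (fun t : ℝ => exp (c i + t * a i)) (exp (c i + t * a i) * a i) t := fun i t => by
    simpa using (((hasDerivAt_id t).mul_const (a i)).const_add (c i)).exp
  have hden : ∀ t : ℝ, 0 < ∑ i, exp (c i + t * a i) := fun t =>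
    sum_pos (fun i _ => exp_pos _) univ_nonempty
  have hderiv : ∀ t : ℝ, HasDerivAt
      (fun t : ℝ => (∑ i, exp (c i + t * a i) * b i) / (∑ i, exp (c i + t * a i)))
      (((∑ i, exp (c i + t * a i) * a i * b i) * (∑ i, exp (c i + t * a i))
        - (∑ i, exp (c i + t * a i) * b i) * (∑ i, exp (c i + t * a i) * a i))
          / (∑ i, exp (c i + t * a i)) ^ 2) t := fun t =>
    (HasDerivAt.fun_sum fun i _ => (hexp i t).mul_const (b i)).fun_div
      (HasDerivAt.fun_sum fun i _ => hexp i t) (hden t).ne'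
  have key := norm_image_sub_le_of_norm_deriv_le_segment_01' (C := A * B)
    (fun t _ => (hderiv t).hasDerivWithinAt) (fun t _ => by
      rw [norm_eq_abs, abs_div, abs_of_pos (pow_pos (hden t) 2), div_le_iff₀ (pow_pos (hden t) 2)]
      exact abs_weighted_covariance_le univ _ a b (fun i _ => (exp_pos _).le) hA hB
        (fun i _ => ha i) (fun i _ => hb i))
  simpa using key

/-- The smoothed optimal transport map
`T̂(x) = (∑ᵢ yᵢ·exp(cᵢ(x)))/(∑ᵢ exp(cᵢ(x)))`, with `cᵢ(x) = (⟨x,yᵢ⟩ + hᵢ)/τ`, is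
Lipschitz continuous with constant `(maxᵢ ‖yᵢ‖₂²)/τ` for the Euclidean norm. -/
theorem smoothed_OT_map_lipschitz (n d : ℕ) (hn : 1 ≤ n)
    (y : Fin n → EuclideanSpace ℝ (Fin d)) (h : Fin n → ℝ) (τ : ℝ) (hτ : 0 < τ) :
    let That : EuclideanSpace ℝ (Fin d) → EuclideanSpace ℝ (Fin d) := fun x =>
      (∑ i, Real.exp ((⟪x, y i⟫ + h i) / τ))⁻¹ •
        ∑ i, Real.exp ((⟪x, y i⟫ + h i) / τ) • y i
    ∀ x₁ x₂ : EuclideanSpace ℝ (Fin d),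
      ‖That x₁ - That x₂‖ ≤ (⨆ i, ‖y i‖ ^ 2) / τ * ‖x₁ - x₂‖ := by
  intro That x₁ x₂
  have : Nonempty (Fin n) := ⟨⟨0, hn⟩⟩
  set M := ⨆ i, ‖y i‖ ^ 2
  have hyM : ∀ i, ‖y i‖ ^ 2 ≤ M := fun i =>
    le_ciSup (Set.finite_range fun i => ‖y i‖ ^ 2).bddAbove i
  have hM0 : 0 ≤ M := Real.iSup_nonneg fun i => sq_nonneg _
  have hy : ∀ i, ‖y i‖ ≤ √M := fun i => Real.le_sqrt_of_sq_le (hyM i)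
  set w := That x₁ - That x₂ with hw
  have hinner : ∀ x, ⟪That x, w⟫ = (∑ i, exp ((⟪x, y i⟫ + h i) / τ) * ⟪y i, w⟫)
      / ∑ i, exp ((⟪x, y i⟫ + h i) / τ) := fun x => by
    simp only [That, real_inner_smul_left, sum_inner]
    rw [div_eq_inv_mul]
  have hshift : ∀ i, (⟪x₁, y i⟫ + h i) / τ
      = (⟪x₂, y i⟫ + h i) / τ + ⟪x₁ - x₂, y i⟫ / τ := fun i => by
    rw [inner_sub_left]; ring
  have hbound := abs_softmax_average_sub_le (fun i => ⟪x₁ - x₂, y i⟫ / τ) (fun i => ⟪y i, w⟫)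
    (fun i => (⟪x₂, y i⟫ + h i) / τ) (A := ‖x₁ - x₂‖ * √M / τ) (B := √M * ‖w‖)
    (by positivity) (by positivity)
    (fun i => by
      rw [abs_div, abs_of_pos hτ]
      have := (abs_real_inner_le_norm (x₁ - x₂) (y i)).trans
        (mul_le_mul_of_nonneg_left (hy i) (norm_nonneg _))
      gcongr)
    (fun i => (abs_real_inner_le_norm _ _).trans
      (mul_le_mul_of_nonneg_right (hy i) (norm_nonneg _)))
  simp only [← hshift] at hbound
  rw [← hinner, ← hinner, ← inner_sub_left, ← hw, real_inner_self_eq_norm_sq, abs_sq] at hbound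
  have hsq : ‖w‖ * ‖w‖ ≤ M / τ * ‖x₁ - x₂‖ * ‖w‖ := by
    calc ‖w‖ * ‖w‖ = ‖w‖ ^ 2 := (sq _).symm
      _ ≤ ‖x₁ - x₂‖ * √M / τ * (√M * ‖w‖) := hbound
      _ = (√M * √M) / τ * ‖x₁ - x₂‖ * ‖w‖ := by ring
      _ = M / τ * ‖x₁ - x₂‖ * ‖w‖ := by rw [Real.mul_self_sqrt hM0]
  rcases (norm_nonneg w).eq_or_lt with h0 | hpos
  · rw [← h0]; positivity
  · exact le_of_mul_le_mul_right hsq hpos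
end

section
/- (Proposition, L² bound on gradient differences of convex functions.) Let X ⊂ ℝᵈ be a nonempty bounded convex open set. There exists a constant C_X > 0, depending only on X, such that for all convex differentiable functions f, g : X → ℝ with bounded gradients, ( ∫_X ‖∇f(x) − ∇g(x)‖₂² dx )^{1/2} ≤ 2 C_X · ( sup_{x ∈ X} |f(x) − g(x)| )^{1/2} · ( ( sup_{x ∈ X} ‖∇f(x)‖₂ )^{1/2} + ( sup_{x ∈ X} ‖∇g(x)‖₂ )^{1/2} ). -/
open Real MeasureTheory

open Set Filter Topology

/-- A relatively upper subset of `(a, b]` is, up to a null set, an interval `(c, b]`. -/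
theorem exists_ae_eq_Ioc_of_isUpper {a b : ℝ} (hab : a ≤ b) {U : Set ℝ} (hU : U ⊆ Ioc a b)
    (hup : ∀ x ∈ U, ∀ y ∈ Ioc a b, x ≤ y → y ∈ U) :
    ∃ c ∈ Icc a b, U =ᵐ[volume] Ioc c b := by
  rcases U.eq_empty_or_nonempty with rfl | hne
  · exact ⟨b, ⟨hab, le_rfl⟩, by simp⟩
  have hbdd : BddBelow U := ⟨a, fun x hx => (hU hx).1.le⟩
  have hac : a ≤ sInf U := le_csInf hne fun x hx => (hU hx).1.le
  obtain ⟨z, hz⟩ := hne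
  refine ⟨sInf U, ⟨hac, (csInf_le hbdd hz).trans (hU hz).2⟩, ?_⟩
  have h₁ : U ⊆ Icc (sInf U) b := fun x hx => ⟨csInf_le hbdd hx, (hU hx).2⟩
  have h₂ : Ioc (sInf U) b ⊆ U := by
    intro y hy
    obtain ⟨x, hx, hxy⟩ := exists_lt_of_csInf_lt ⟨z, hz⟩ hy.1
    exact hup x hx y ⟨hac.trans_lt hy.1, hy.2⟩ hxy.le
  exact (h₁.eventuallyLE.trans Ioc_ae_eq_Icc.symm.le).antisymm h₂.eventuallyLE

/-- A bound in the spirit of the second mean value theorem for integrals: if all tail integrals of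
`u` are bounded by `K`, then the integral of `u` against a monotone function bounded by `L` is
bounded by `3 * K * L`. -/
theorem abs_setIntegral_mul_le_of_monotoneOn {a b K L : ℝ} (hab : a ≤ b) {u w : ℝ → ℝ}
    (hu : IntegrableOn u (Ioc a b)) (hw : Measurable w) (hmono : MonotoneOn w (Ioc a b))
    (hL : ∀ x ∈ Ioc a b, |w x| ≤ L) (hL0 : 0 ≤ L)
    (hK : ∀ c ∈ Icc a b, |∫ x in Ioc c b, u x| ≤ K) :
    |∫ x in Ioc a b, u x * w x| ≤ 3 * K * L := by
  set μ := volume.restrict (Ioc a b) with hμ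
  set ν := volume.restrict (Ioc (-L) L) with hν
  set F : ℝ × ℝ → ℝ := indicator {p | p.2 < w p.1} (fun p => u p.1) with hF
  have hFint : Integrable F (μ.prod ν) :=
    (Integrable.comp_fst hu ν).indicator
      (measurableSet_lt measurable_snd (hw.comp measurable_fst))
  have hswap : ∫ x, ∫ s, F (x, s) ∂ν ∂μ = ∫ s, ∫ x, F (x, s) ∂μ ∂ν :=
    integral_integral_swap (f := fun x s => F (x, s)) hFint
  have hleft : ∫ x, ∫ s, F (x, s) ∂ν ∂μ = ∫ x, u x * (w x + L) ∂μ := by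
    refine setIntegral_congr_fun measurableSet_Ioc fun x hx => ?_
    have hFx : (fun s => F (x, s)) = indicator (Iio (w x)) (fun _ => u x) := by
      ext s; simp [hF, indicator]
    have hwx := abs_le.1 (hL x hx)
    have hset : Iio (w x) ∩ Ioc (-L) L = Ioo (-L) (w x) := by
      ext s
      simp only [mem_inter_iff, mem_Iio, mem_Ioc, mem_Ioo]
      constructor
      · rintro ⟨h, h', -⟩; exact ⟨h', h⟩
      · rintro ⟨h, h'⟩; exact ⟨h', h, h'.le.trans hwx.2⟩
    simp only [hFx]
    rw [integral_indicator measurableSet_Iio, setIntegral_const, hν,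
      measureReal_restrict_apply measurableSet_Iio, hset, Real.volume_real_Ioo_of_le hwx.1,
      smul_eq_mul]
    ring
  have hright : |∫ s, ∫ x, F (x, s) ∂μ ∂ν| ≤ K * (2 * L) := by
    have hb : ∀ s, ‖∫ x, F (x, s) ∂μ‖ ≤ K := by
      intro s
      have hFs : (fun x => F (x, s)) = indicator {x | s < w x} u := by
        ext x; simp [hF, indicator]
      have hms : MeasurableSet {x | s < w x} := measurableSet_lt measurable_const hw
      obtain ⟨c, hc, hae⟩ := exists_ae_eq_Ioc_of_isUpper hab
        (U := {x | s < w x} ∩ Ioc a b) inter_subset_right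
        (fun x hx y hy hxy => ⟨lt_of_lt_of_le hx.1 (hmono hx.2 hy hxy), hy⟩)
      rw [hFs, integral_indicator hms, hμ, Measure.restrict_restrict hms,
        setIntegral_congr_set hae]
      exact hK c hc
    have := norm_setIntegral_le_of_norm_le_const (μ := volume) (s := Ioc (-L) L)
      (f := fun s => ∫ x, F (x, s) ∂μ) (C := K) (by simp) (fun s _ => hb s)
    rw [Real.volume_real_Ioc_of_le (by linarith)] at this
    calc _ ≤ _ := this
      _ = _ := by ring
  have huw : Integrable (fun x => u x * w x) μ := by
    refine Integrable.mul_bdd (c := L) hu hw.aestronglyMeasurable ?_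
    exact (ae_restrict_iff' measurableSet_Ioc).2 (Eventually.of_forall hL)
  have hsplit : ∫ x, u x * (w x + L) ∂μ = (∫ x, u x * w x ∂μ) + (∫ x, u x ∂μ) * L := by
    rw [← integral_mul_const, ← integral_add huw (hu.mul_const L)]
    simp only [mul_add]
  have h0 := abs_le.1 (hK a ⟨le_rfl, hab⟩)
  rw [← hswap, hleft, hsplit] at hright
  have h1 := abs_le.1 hright
  rw [abs_le]
  constructor <;> nlinarith [mul_le_mul_of_nonneg_right h0.1 hL0,
    mul_le_mul_of_nonneg_right h0.2 hL0]

/-- One-dimensional estimate on a compact interval. -/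
theorem setIntegral_sq_deriv_sub_le {a b M A B : ℝ} (hab : a ≤ b) {φ ψ : ℝ → ℝ}
    (hφ : ConvexOn ℝ (Icc a b) φ) (hψ : ConvexOn ℝ (Icc a b) ψ)
    (hφd : ∀ x ∈ Icc a b, DifferentiableAt ℝ φ x) (hψd : ∀ x ∈ Icc a b, DifferentiableAt ℝ ψ x)
    (hA : ∀ x ∈ Icc a b, |deriv φ x| ≤ A) (hB : ∀ x ∈ Icc a b, |deriv ψ x| ≤ B)
    (hM : ∀ x ∈ Icc a b, |φ x - ψ x| ≤ M) :
    IntegrableOn (fun x => (deriv φ x - deriv ψ x) ^ 2) (Icc a b) ∧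
    ∫ x in Icc a b, (deriv φ x - deriv ψ x) ^ 2 ≤ 6 * M * (A + B) := by
  have hmφ := (hφ.monotoneOn_deriv hφd)
  have hmψ := (hψ.monotoneOn_deriv hψd)
  have hiφ : IntegrableOn (deriv φ) (Icc a b) := hmφ.integrableOn_isCompact isCompact_Icc
  have hiψ : IntegrableOn (deriv ψ) (Icc a b) := hmψ.integrableOn_isCompact isCompact_Icc
  have hi := hiφ.sub hiψ
  have ha : a ∈ Icc a b := ⟨le_rfl, hab⟩
  have hA0 : 0 ≤ A := (abs_nonneg _).trans (hA a ha)
  have hB0 : 0 ≤ B := (abs_nonneg _).trans (hB a ha)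
  have hK : ∀ c ∈ Icc a b, |∫ x in Ioc c b, (deriv φ x - deriv ψ x)| ≤ 2 * M := by
    intro c hc
    have hsub : Icc c b ⊆ Icc a b := Icc_subset_Icc_left hc.1
    rw [← intervalIntegral.integral_of_le hc.2,
      intervalIntegral.integral_eq_sub_of_hasDerivAt (f := fun x => φ x - ψ x)]
    · have h1 := abs_le.1 (hM c hc)
      have h2 := abs_le.1 (hM b ⟨hab, le_rfl⟩)
      rw [abs_le]; constructor <;> linarith
    · intro x hx
      rw [uIcc_of_le hc.2] at hx
      exact (hφd x (hsub hx)).hasDerivAt.sub (hψd x (hsub hx)).hasDerivAt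
    · exact (intervalIntegrable_iff_integrableOn_Icc_of_le hc.2).2 (hi.mono_set hsub)
  have hu : IntegrableOn (fun x => deriv φ x - deriv ψ x) (Ioc a b) :=
    hi.mono_set Ioc_subset_Icc_self
  have hprod : ∀ (w : ℝ → ℝ) (L : ℝ), Measurable w → (∀ x ∈ Icc a b, |w x| ≤ L) →
      IntegrableOn (fun x => (deriv φ x - deriv ψ x) * w x) (Icc a b) := fun w L hw hL =>
    Integrable.mul_bdd (c := L) hi hw.aestronglyMeasurable
      ((ae_restrict_iff' measurableSet_Icc).2 (Eventually.of_forall hL))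
  have hpφ := hprod _ A (measurable_deriv φ) hA
  have hpψ := hprod _ B (measurable_deriv ψ) hB
  have heq : (fun x => (deriv φ x - deriv ψ x) ^ 2) = fun x =>
      (deriv φ x - deriv ψ x) * deriv φ x - (deriv φ x - deriv ψ x) * deriv ψ x := by
    ext x; ring
  rw [heq]
  refine ⟨hpφ.sub hpψ, ?_⟩
  rw [integral_sub hpφ hpψ, integral_Icc_eq_integral_Ioc, integral_Icc_eq_integral_Ioc]
  have h1 := abs_le.1 (abs_setIntegral_mul_le_of_monotoneOn hab hu (measurable_deriv φ)
    (hmφ.mono Ioc_subset_Icc_self) (fun x hx => hA x (Ioc_subset_Icc_self hx)) hA0 hK)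
  have h2 := abs_le.1 (abs_setIntegral_mul_le_of_monotoneOn hab hu (measurable_deriv ψ)
    (hmψ.mono Ioc_subset_Icc_self) (fun x hx => hB x (Ioc_subset_Icc_self hx)) hB0 hK)
  linarith

/-- One-dimensional estimate on a bounded open interval. -/
theorem setLIntegral_sq_deriv_sub_le {M A B : ℝ} {S : Set ℝ} (hS : Convex ℝ S) (hSo : IsOpen S)
    (hSb : Bornology.IsBounded S) {φ ψ : ℝ → ℝ}
    (hφ : ConvexOn ℝ S φ) (hψ : ConvexOn ℝ S ψ)
    (hφd : ∀ x ∈ S, DifferentiableAt ℝ φ x) (hψd : ∀ x ∈ S, DifferentiableAt ℝ ψ x)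
    (hA : ∀ x ∈ S, |deriv φ x| ≤ A) (hB : ∀ x ∈ S, |deriv ψ x| ≤ B)
    (hM : ∀ x ∈ S, |φ x - ψ x| ≤ M) :
    ∫⁻ x in S, ENNReal.ofReal ((deriv φ x - deriv ψ x) ^ 2) ≤
      ENNReal.ofReal (6 * M * (A + B)) := by
  rcases S.eq_empty_or_nonempty with rfl | hne
  · simp
  set α := sInf S
  set β := sSup S
  have hsub : Ioo α β ⊆ S := IsConnected.Ioo_csInf_csSup_subset
    ⟨hne, hS.isPreconnected⟩ hSb.bddBelow hSb.bddAbove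
  have hsup : S ⊆ Icc α β := fun x hx => ⟨csInf_le hSb.bddBelow hx, le_csSup hSb.bddAbove hx⟩
  have hae : S =ᵐ[volume] Ioo α β :=
    (hsup.eventuallyLE.trans Ioo_ae_eq_Icc.symm.le).antisymm hsub.eventuallyLE
  rw [setLIntegral_congr hae]
  have hαβ : α < β := by
    obtain ⟨x, hx⟩ := hne
    obtain ⟨ε, hε, hball⟩ := Metric.isOpen_iff.1 hSo x hx
    have h : x + ε / 2 ∈ S := hball (by simp [abs_of_pos hε, hε])
    linarith [csInf_le hSb.bddBelow hx, le_csSup hSb.bddAbove h]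
  have hmeas : Measurable fun x => ENNReal.ofReal ((deriv φ x - deriv ψ x) ^ 2) :=
    (((measurable_deriv φ).sub (measurable_deriv ψ)).pow_const 2).ennreal_ofReal
  have hcov : AECover (volume.restrict (Ioo α β)) (𝓝[>] (0 : ℝ))
      (fun t => Icc (α + t) (β - t)) := by
    refine aecover_Ioo_of_Icc ?_ ?_
    · exact ((continuous_const.add continuous_id).tendsto' _ _ (add_zero α)).mono_left
        nhdsWithin_le_nhds
    · exact ((continuous_const.sub continuous_id).tendsto' _ _ (sub_zero β)).mono_left
        nhdsWithin_le_nhds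
  refine le_of_tendsto (hcov.lintegral_tendsto_of_countably_generated hmeas.aemeasurable) ?_
  filter_upwards [Ioo_mem_nhdsGT (show (0 : ℝ) < (β - α) / 2 by linarith)] with t ht
  have hle : α + t ≤ β - t := by linarith [ht.2]
  have hT : Icc (α + t) (β - t) ⊆ Ioo α β := fun x hx =>
    ⟨by linarith [hx.1, ht.1], by linarith [hx.2, ht.1]⟩
  have hTS := hT.trans hsub
  obtain ⟨hint, hbound⟩ := setIntegral_sq_deriv_sub_le hle (hφ.subset hTS (convex_Icc _ _))
    (hψ.subset hTS (convex_Icc _ _)) (fun x hx => hφd x (hTS hx)) (fun x hx => hψd x (hTS hx))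
    (fun x hx => hA x (hTS hx)) (fun x hx => hB x (hTS hx)) (fun x hx => hM x (hTS hx))
  rw [Measure.restrict_restrict measurableSet_Icc, inter_eq_left.2 hT,
    ← ofReal_integral_eq_lintegral_ofReal hint (Eventually.of_forall fun x => sq_nonneg _)]
  exact ENNReal.ofReal_le_ofReal hbound

section Directional

variable {E : Type*} [NormedAddCommGroup E] [NormedSpace ℝ E] [FiniteDimensional ℝ E]
  [MeasurableSpace E] [BorelSpace E]

/-- Slicing estimate for a directional derivative: the one-dimensional estimate is averaged over
all unit segments in the direction `e`. -/
theorem setLIntegral_sq_fderiv_sub_le (μ : Measure E) [μ.IsAddHaarMeasure] {X : Set E}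
    (hX : Convex ℝ X) (hXo : IsOpen X) {z : E} {R : ℝ} (hR : X ⊆ Metric.ball z R)
    {e : E} (he : ‖e‖ ≤ 1) {f g : E → ℝ} (hf : ConvexOn ℝ X f) (hg : ConvexOn ℝ X g)
    (hfd : ∀ x ∈ X, DifferentiableAt ℝ f x) (hgd : ∀ x ∈ X, DifferentiableAt ℝ g x)
    {M A B : ℝ} (hA : ∀ x ∈ X, |fderiv ℝ f x e| ≤ A) (hB : ∀ x ∈ X, |fderiv ℝ g x e| ≤ B)
    (hM : ∀ x ∈ X, |f x - g x| ≤ M) :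
    ∫⁻ x in X, ENNReal.ofReal ((fderiv ℝ f x e - fderiv ℝ g x e) ^ 2) ∂μ ≤
      ENNReal.ofReal (6 * M * (A + B)) * μ (Metric.ball z (R + 1)) := by
  set F : E → ENNReal := indicator X
    (fun x => ENNReal.ofReal ((fderiv ℝ f x e - fderiv ℝ g x e) ^ 2)) with hF
  have hFm : Measurable F :=
    ((((measurable_fderiv_apply_const ℝ f e).sub
      (measurable_fderiv_apply_const ℝ g e)).pow_const 2).ennreal_ofReal).indicator
      hXo.measurableSet
  have hline : ∀ x, ∫⁻ t in Ioo (0 : ℝ) 1, F (x + t • e) ≤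
      indicator (Metric.ball z (R + 1)) (fun _ => ENNReal.ofReal (6 * M * (A + B))) x := by
    intro x
    by_cases hx : x ∈ Metric.ball z (R + 1)
    · rw [indicator_of_mem hx]
      set ℓ : ℝ →ᵃ[ℝ] E := AffineMap.lineMap x (x + e) with hℓ
      have hℓt : ∀ t, ℓ t = x + t • e := fun t => by
        simp [hℓ, AffineMap.lineMap_apply, add_comm]
      have hℓc : Continuous ℓ := AffineMap.lineMap_continuous
      set S : Set ℝ := Ioo 0 1 ∩ ℓ ⁻¹' X with hS
      have hSX : ∀ t ∈ S, x + t • e ∈ X := fun t ht => by simpa [hℓt] using ht.2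
      have hSc : Convex ℝ S := (convex_Ioo 0 1).inter (hX.affine_preimage ℓ)
      have hSo : IsOpen S := isOpen_Ioo.inter (hXo.preimage hℓc)
      have hSb : Bornology.IsBounded S := (Metric.isBounded_Ioo 0 1).subset inter_subset_left
      have hderiv : ∀ k : E → ℝ, (∀ y ∈ X, DifferentiableAt ℝ k y) → ∀ t ∈ S,
          HasDerivAt (k ∘ ℓ) (fderiv ℝ k (x + t • e) e) t := by
        intro k hk t ht
        have h1 : HasDerivAt (fun t : ℝ => x + t • e) e t := by
          simpa using ((hasDerivAt_id t).smul_const e).const_add x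
        have h2 := (hk _ (hSX t ht)).hasFDerivAt.comp_hasDerivAt t h1
        have h3 : k ∘ ℓ = k ∘ fun t : ℝ => x + t • e := by ext t; simp [hℓt]
        rwa [h3]
      have hcomp : ∀ k : E → ℝ, ConvexOn ℝ X k → ConvexOn ℝ S (k ∘ ℓ) := fun k hk =>
        (hk.comp_affineMap ℓ).subset inter_subset_right hSc
      have key := setLIntegral_sq_deriv_sub_le (M := M) (A := A) (B := B) hSc hSo hSb
        (hcomp f hf) (hcomp g hg)
        (fun t ht => (hderiv f hfd t ht).differentiableAt)
        (fun t ht => (hderiv g hgd t ht).differentiableAt)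
        (fun t ht => by rw [(hderiv f hfd t ht).deriv]; exact hA _ (hSX t ht))
        (fun t ht => by rw [(hderiv g hgd t ht).deriv]; exact hB _ (hSX t ht))
        (fun t ht => by simpa [hℓt] using hM _ (hSX t ht))
      refine le_trans (le_of_eq ?_) key
      have hind : (fun t : ℝ => F (x + t • e)) = indicator (ℓ ⁻¹' X) (fun t =>
          ENNReal.ofReal ((fderiv ℝ f (x + t • e) e - fderiv ℝ g (x + t • e) e) ^ 2)) := by
        simp only [hF, ← hℓt]
        ext t
        by_cases ht : ℓ t ∈ X
        · rw [indicator_of_mem ht, indicator_of_mem (mem_preimage.2 ht)]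
        · rw [indicator_of_notMem ht, indicator_of_notMem (mt mem_preimage.1 ht)]
      have hpm : MeasurableSet (ℓ ⁻¹' X) := (hXo.preimage hℓc).measurableSet
      rw [hind, lintegral_indicator hpm, Measure.restrict_restrict hpm, inter_comm]
      refine setLIntegral_congr_fun hSo.measurableSet fun t ht => ?_
      simp only [(hderiv f hfd t ht).deriv, (hderiv g hgd t ht).deriv]
    · rw [indicator_of_notMem hx, nonpos_iff_eq_zero]
      refine (setLIntegral_congr_fun (g := fun _ => 0) measurableSet_Ioo fun t ht => ?_).trans
        (by simp)
      refine indicator_of_notMem (fun hmem => hx ?_) _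
      have h1 := mem_ball_iff_norm.1 (hR hmem)
      rw [mem_ball_iff_norm]
      calc ‖x - z‖ = ‖(x + t • e - z) - t • e‖ := by congr 1; abel
        _ ≤ ‖x + t • e - z‖ + ‖t • e‖ := norm_sub_le _ _
        _ < R + 1 := by
          have : ‖t • e‖ ≤ 1 := by
            rw [norm_smul, Real.norm_of_nonneg ht.1.le]
            exact mul_le_one₀ ht.2.le (norm_nonneg _) he
          linarith
  have hjoint : Measurable fun p : ℝ × E => F (p.2 + p.1 • e) :=
    hFm.comp (by fun_prop)
  calc ∫⁻ x in X, ENNReal.ofReal ((fderiv ℝ f x e - fderiv ℝ g x e) ^ 2) ∂μ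
      = ∫⁻ x, F x ∂μ := (lintegral_indicator hXo.measurableSet _).symm
    _ = ∫⁻ _ in Ioo (0 : ℝ) 1, ∫⁻ x, F x ∂μ := by simp
    _ = ∫⁻ t in Ioo (0 : ℝ) 1, ∫⁻ x, F (x + t • e) ∂μ := by
      simp only [lintegral_add_right_eq_self]
    _ = ∫⁻ x, (∫⁻ t in Ioo (0 : ℝ) 1, F (x + t • e)) ∂μ :=
      lintegral_lintegral_swap hjoint.aemeasurable
    _ ≤ _ := lintegral_mono hline
    _ = _ := by rw [lintegral_indicator_const Metric.isOpen_ball.measurableSet]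

end Directional

/-- Proposition (L² bound on gradient differences of convex functions): for a nonempty
bounded convex open set `X ⊂ ℝᵈ` there is a constant `C_X > 0`, depending only on `X`,
such that for all convex differentiable `f, g : X → ℝ` with bounded gradients,
`‖∇f - ∇g‖_{L²(X)} ≤ 2 C_X ‖f - g‖_∞^{1/2} (‖∇f‖_∞^{1/2} + ‖∇g‖_∞^{1/2})`. -/
theorem l2_bound_gradient_difference_convex (d : ℕ)
    (X : Set (EuclideanSpace ℝ (Fin d))) (hne : X.Nonempty)
    (hbd : Bornology.IsBounded X) (hconv : Convex ℝ X) (hopen : IsOpen X) :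
    ∃ C : ℝ, 0 < C ∧
      ∀ f g : EuclideanSpace ℝ (Fin d) → ℝ,
        ConvexOn ℝ X f → ConvexOn ℝ X g →
        (∀ x ∈ X, DifferentiableAt ℝ f x) → (∀ x ∈ X, DifferentiableAt ℝ g x) →
        BddAbove ((fun x => ‖gradient f x‖) '' X) →
        BddAbove ((fun x => ‖gradient g x‖) '' X) →
        BddAbove ((fun x => |f x - g x|) '' X) →
        (∫ x in X, ‖gradient f x - gradient g x‖ ^ 2) ^ (1 / 2 : ℝ) ≤
          2 * C * (⨆ x : X, |f x - g x|) ^ (1 / 2 : ℝ) *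
            ((⨆ x : X, ‖gradient f x‖) ^ (1 / 2 : ℝ) +
              (⨆ x : X, ‖gradient g x‖) ^ (1 / 2 : ℝ)) := by
  obtain ⟨z, hz⟩ := hne
  obtain ⟨R, hR⟩ := hbd.subset_ball z
  set V : ℝ := volume.real (Metric.ball z (R + 1)) with hV
  have hV0 : 0 ≤ V := measureReal_nonneg
  refine ⟨√(6 * d * V) + 1, by positivity, ?_⟩
  intro f g hf hg hfd hgd hbf hbg hbM
  rw [image_eq_range] at hbf hbg hbM
  set M := ⨆ x : X, |f x - g x|
  set A := ⨆ x : X, ‖gradient f x‖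
  set B := ⨆ x : X, ‖gradient g x‖
  have hM : ∀ x ∈ X, |f x - g x| ≤ M := fun x hx => le_ciSup hbM ⟨x, hx⟩
  have hA : ∀ x ∈ X, ‖gradient f x‖ ≤ A := fun x hx => le_ciSup hbf ⟨x, hx⟩
  have hB : ∀ x ∈ X, ‖gradient g x‖ ≤ B := fun x hx => le_ciSup hbg ⟨x, hx⟩
  have hM0 : 0 ≤ M := (abs_nonneg _).trans (hM z hz)
  have hA0 : 0 ≤ A := (norm_nonneg _).trans (hA z hz)
  have hB0 : 0 ≤ B := (norm_nonneg _).trans (hB z hz)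
  set e : Fin d → EuclideanSpace ℝ (Fin d) := fun i => EuclideanSpace.single i 1 with he
  have hen : ∀ i, ‖e i‖ ≤ 1 := fun i => by simp [he]
  have hcoord : ∀ (k : EuclideanSpace ℝ (Fin d) → ℝ) x i,
      gradient k x i = fderiv ℝ k x (e i) := by
    intro k x i
    rw [gradient, ← InnerProductSpace.toDual_symm_apply (x := e i) (y := fderiv ℝ k x),
      EuclideanSpace.inner_single_right]
    simp
  have hdir : ∀ (k : EuclideanSpace ℝ (Fin d) → ℝ) x i, |fderiv ℝ k x (e i)| ≤ ‖gradient k x‖ := by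
    intro k x i
    rw [← hcoord]
    exact PiLp.norm_apply_le (gradient k x) i
  have hnorm : ∀ x, ‖gradient f x - gradient g x‖ ^ 2 =
      ∑ i, (fderiv ℝ f x (e i) - fderiv ℝ g x (e i)) ^ 2 := by
    intro x
    simp [EuclideanSpace.real_norm_sq_eq, hcoord]
  have hmeas : ∀ i, Measurable fun x => (fderiv ℝ f x (e i) - fderiv ℝ g x (e i)) ^ 2 :=
    fun i => ((measurable_fderiv_apply_const ℝ f (e i)).sub
      (measurable_fderiv_apply_const ℝ g (e i))).pow_const 2
  have hI : ∫ x in X, ‖gradient f x - gradient g x‖ ^ 2 ≤ 6 * d * V * (M * (A + B)) := by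
    simp only [hnorm]
    rw [integral_eq_lintegral_of_nonneg_ae
      (Eventually.of_forall fun x => Finset.sum_nonneg fun i _ => sq_nonneg _)
      (Finset.measurable_sum _ fun i _ => hmeas i).aestronglyMeasurable]
    refine ENNReal.toReal_le_of_le_ofReal (by positivity) ?_
    simp only [ENNReal.ofReal_sum_of_nonneg fun i _ => sq_nonneg _]
    rw [lintegral_finsetSum _ fun i _ => (hmeas i).ennreal_ofReal]
    calc _ ≤ ∑ _i : Fin d, ENNReal.ofReal (6 * M * (A + B)) *
          volume (Metric.ball z (R + 1)) :=
          Finset.sum_le_sum fun i _ => setLIntegral_sq_fderiv_sub_le volume hconv hopen hR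
            (hen i) hf hg hfd hgd (fun x hx => (hdir f x i).trans (hA x hx))
            (fun x hx => (hdir g x i).trans (hB x hx)) hM
      _ = ENNReal.ofReal (6 * d * V * (M * (A + B))) := by
          rw [Finset.sum_const, Finset.card_univ, Fintype.card_fin, nsmul_eq_mul,
            ← ofReal_measureReal (by exact measure_ball_lt_top.ne), ← hV,
            ← ENNReal.ofReal_natCast, ← ENNReal.ofReal_mul (by positivity),
            ← ENNReal.ofReal_mul (by positivity)]
          congr 1; ring
  simp only [← Real.sqrt_eq_rpow]
  calc √(∫ x in X, ‖gradient f x - gradient g x‖ ^ 2)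
      ≤ √(6 * d * V * (M * (A + B))) := Real.sqrt_le_sqrt hI
    _ = √(6 * d * V) * √M * √(A + B) := by
        rw [Real.sqrt_mul (by positivity), Real.sqrt_mul hM0, ← mul_assoc]
    _ ≤ (2 * (√(6 * d * V) + 1)) * √M * (√A + √B) := by
        have := Real.sqrt_nonneg (6 * d * V)
        have h : √(A + B) ≤ √A + √B := Real.sqrt_le_iff.2 ⟨by positivity, by
          nlinarith [Real.sq_sqrt hA0, Real.sq_sqrt hB0,
            mul_nonneg (Real.sqrt_nonneg A) (Real.sqrt_nonneg B)]⟩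
        gcongr
        linarith
end
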